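/- Let Q be an n×n bisymmetric permutation matrix, P an MCPM of order n, and A an n×n magic square with magic number μ of type A_P, i.e., A + P·A·P = (2μ/n)·E. Set P′ = Q·P·Q. Then P′ is an MCPM of order n and Q·A·Q is a magic square of type A_{P′}, i.e., Q·A·Q + P′·(Q·A·Q)·P′ = (2μ/n)·E. -/

import Mathlib

open Matrix

/-- The `n × n` reverse matrix `J`: (1-indexed) `J i j = 1` iff `i + j = n + 1`. -/
def revMat (n : ℕ) : Matrix (Fin n) (Fin n) ℝ :=
  Matrix.of fun i j => if (i : ℕ) + (j : ℕ) + 1 = n then 1 else 0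

/-- The `n × n` all-ones matrix `E`. -/
def allOnes (n : ℕ) : Matrix (Fin n) (Fin n) ℝ :=
  Matrix.of fun _ _ => 1

/-- `A` is a magic square with magic number `μ`: all rows, all columns, the main
diagonal and the minor diagonal sum to `μ`. -/
def IsMagic {n : ℕ} (A : Matrix (Fin n) (Fin n) ℝ) (μ : ℝ) : Prop :=
  (∀ i, ∑ j, A i j = μ) ∧ (∀ j, ∑ i, A i j = μ) ∧
    A.trace = μ ∧ (revMat n * A).trace = μ

/-- `A` is a semi-magic square with magic number `μ`: all rows and columns sum to `μ`. -/
def IsSemiMagic {n : ℕ} (A : Matrix (Fin n) (Fin n) ℝ) (μ : ℝ) : Prop :=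
  (∀ i, ∑ j, A i j = μ) ∧ (∀ j, ∑ i, A i j = μ)

/-- `P` is a permutation matrix: a 0–1 matrix with exactly one 1 in each row and column. -/
def IsPermMat {n : ℕ} (P : Matrix (Fin n) (Fin n) ℝ) : Prop :=
  (∀ i j, P i j = 0 ∨ P i j = 1) ∧ (∀ i, ∃! j, P i j = 1) ∧ (∀ j, ∃! i, P i j = 1)

/-- A square matrix is bisymmetric if it is symmetric and persymmetric. -/
def IsBisym {n : ℕ} (P : Matrix (Fin n) (Fin n) ℝ) : Prop :=
  P = Pᵀ ∧ revMat n * P = (revMat n * P)ᵀ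

/-- A square matrix is 90°-symmetric if `Pᵀ = J * P`. -/
def IsRot90 {n : ℕ} (P : Matrix (Fin n) (Fin n) ℝ) : Prop :=
  Pᵀ = revMat n * P

/-- A magic classifying permutation matrix (MCPM): a symmetric permutation matrix with
trace 0 when `n` is even; when `n` is odd, the middle diagonal entry is 1 and the trace is 1. -/
def IsMCPM {n : ℕ} (P : Matrix (Fin n) (Fin n) ℝ) : Prop :=
  IsPermMat P ∧ P = Pᵀ ∧
    ((Even n ∧ P.trace = 0) ∨
      (Odd n ∧ P.trace = 1 ∧ ∀ i : Fin n, (i : ℕ) = n / 2 → P i i = 1))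

/-- `A` is a natural magic square matrix: its entries are a rearrangement of `1, …, n²`. -/
def IsNatural {n : ℕ} (A : Matrix (Fin n) (Fin n) ℝ) : Prop :=
  Function.Injective (fun p : Fin n × Fin n => A p.1 p.2) ∧
    ∀ i j, ∃ k : Fin (n * n), A i j = (k : ℝ) + 1


lemma revMat_apply {n : ℕ} (i j : Fin n) :
    revMat n i j = if i.rev = j then 1 else 0 := by
  simp only [revMat, Matrix.of_apply, Fin.ext_iff, Fin.val_rev]
  congr 1
  exact propext (by omega)

lemma revMat_mul_apply {n : ℕ} (M : Matrix (Fin n) (Fin n) ℝ) (i j : Fin n) :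
    (revMat n * M) i j = M i.rev j := by
  simp [Matrix.mul_apply, revMat_apply]

/-- A symmetric permutation matrix is the matrix of an involution. -/
lemma IsPermMat.exists_involutive {n : ℕ} {Q : Matrix (Fin n) (Fin n) ℝ}
    (hQ : IsPermMat Q) (hsymm : Q = Qᵀ) :
    ∃ σ : Equiv.Perm (Fin n), Function.Involutive σ ∧
      ∀ i j, Q i j = if σ i = j then 1 else 0 := by
  obtain ⟨h01, hrow, -⟩ := hQ
  choose f hf hfu using hrow
  have hinv : Function.Involutive f := fun i => by
    refine (hfu (f i) i ?_).symm
    rw [hsymm]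
    exact hf i
  refine ⟨hinv.toPerm f, hinv, fun i j => ?_⟩
  change Q i j = if f i = j then 1 else 0
  split_ifs with h
  · exact h ▸ hf i
  · exact (h01 i j).resolve_right fun h1 => h (hfu i j h1).symm

lemma mul_mul_eq_submatrix {n : ℕ} {Q : Matrix (Fin n) (Fin n) ℝ} {σ : Equiv.Perm (Fin n)}
    (hσ : Function.Involutive σ) (hQ : ∀ i j, Q i j = if σ i = j then 1 else 0)
    (M : Matrix (Fin n) (Fin n) ℝ) : Q * M * Q = M.submatrix σ σ := by
  ext i j
  have h : ∀ k, (σ k = j) = (k = σ j) := fun k => propext hσ.eq_iff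
  simp [Matrix.mul_apply, hQ, h]

/-- The involution underlying a bisymmetric permutation matrix commutes with reversal. -/
lemma IsBisym.apply_rev {n : ℕ} {Q : Matrix (Fin n) (Fin n) ℝ} (hQb : IsBisym Q)
    {σ : Equiv.Perm (Fin n)} (hσ : Function.Involutive σ)
    (hQ : ∀ i j, Q i j = if σ i = j then 1 else 0) (i : Fin n) :
    σ i.rev = (σ i).rev := by
  have h := congrFun (congrFun hQb.2 i.rev) (σ i)
  rw [Matrix.transpose_apply, revMat_mul_apply, revMat_mul_apply, hQ, hQ, Fin.rev_rev,
    if_pos rfl] at h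
  have h' : σ (σ i).rev = i.rev := by
    by_contra hne
    simp [hne] at h
  rw [← h', hσ]

lemma trace_submatrix_perm {n : ℕ} (σ : Equiv.Perm (Fin n)) (M : Matrix (Fin n) (Fin n) ℝ) :
    (M.submatrix σ σ).trace = M.trace :=
  Equiv.sum_comp σ fun i => M i i

lemma revMat_submatrix {n : ℕ} {σ : Equiv.Perm (Fin n)} (h : ∀ i : Fin n, σ i.rev = (σ i).rev) :
    (revMat n).submatrix σ σ = revMat n := by
  ext i j
  simp [revMat_apply, ← h]

lemma IsPermMat.submatrix {n : ℕ} {P : Matrix (Fin n) (Fin n) ℝ} (hP : IsPermMat P)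
    (σ : Equiv.Perm (Fin n)) : IsPermMat (P.submatrix σ σ) :=
  ⟨fun i j => hP.1 (σ i) (σ j),
    fun i => (σ.bijective.existsUnique_iff (p := fun j => P (σ i) j = 1)).1 (hP.2.1 (σ i)),
    fun j => (σ.bijective.existsUnique_iff (p := fun i => P i (σ j) = 1)).1 (hP.2.2 (σ j))⟩

lemma IsMCPM.submatrix {n : ℕ} {P : Matrix (Fin n) (Fin n) ℝ} (hP : IsMCPM P)
    {σ : Equiv.Perm (Fin n)} (h : ∀ i : Fin n, σ i.rev = (σ i).rev) :
    IsMCPM (P.submatrix σ σ) := by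
  obtain ⟨hperm, hsymm, htr⟩ := hP
  refine ⟨hperm.submatrix σ, by rw [Matrix.transpose_submatrix, ← hsymm], ?_⟩
  rw [trace_submatrix_perm]
  refine htr.imp_right fun ⟨hodd, ht, hmid⟩ => ⟨hodd, ht, fun i hi => hmid (σ i) ?_⟩
  have hrev : i.rev = i := by
    rw [Fin.ext_iff, Fin.val_rev]
    obtain ⟨k, hk⟩ := hodd
    omega
  have hσi := congrArg Fin.val (h i)
  rw [hrev, Fin.val_rev] at hσi
  have := (σ i).isLt
  omega

lemma IsMagic.submatrix {n : ℕ} {A : Matrix (Fin n) (Fin n) ℝ} {μ : ℝ} (hA : IsMagic A μ)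
    {σ : Equiv.Perm (Fin n)} (h : ∀ i : Fin n, σ i.rev = (σ i).rev) :
    IsMagic (A.submatrix σ σ) μ := by
  obtain ⟨hrow, hcol, htr, hanti⟩ := hA
  refine ⟨fun i => (Equiv.sum_comp σ fun j => A (σ i) j).trans (hrow _),
    fun j => (Equiv.sum_comp σ fun i => A i (σ j)).trans (hcol _),
    (trace_submatrix_perm σ A).trans htr, ?_⟩
  rw [← revMat_submatrix h, Matrix.submatrix_mul_equiv, trace_submatrix_perm, hanti]

/-- conjugating a type `A_P` magic square by a bisymmetric permutation matrix
`Q` gives a type `A_{Q·P·Q}` magic square. -/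
theorem bisym_conj_typeA {n : ℕ} (Q P A : Matrix (Fin n) (Fin n) ℝ) (μ : ℝ)
    (hQ : IsPermMat Q) (hQb : IsBisym Q) (hP : IsMCPM P) (hA : IsMagic A μ)
    (htype : A + P * A * P = (2 * μ / (n : ℝ)) • allOnes n) :
    IsMCPM (Q * P * Q) ∧ IsMagic (Q * A * Q) μ ∧
      Q * A * Q + (Q * P * Q) * (Q * A * Q) * (Q * P * Q) =
        (2 * μ / (n : ℝ)) • allOnes n := by
  obtain ⟨σ, hσ, hQσ⟩ := hQ.exists_involutive hQb.1
  have hrev := hQb.apply_rev hσ hQσ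
  simp only [mul_mul_eq_submatrix hσ hQσ]
  refine ⟨hP.submatrix hrev, hA.submatrix hrev, ?_⟩
  rw [Matrix.submatrix_mul_equiv, Matrix.submatrix_mul_equiv]
  exact congrArg (fun M => M.submatrix σ σ) htype
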